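/- Fix n ∈ ℕ and let u ∈ C_c^∞(ℝ^n) be not identically zero and such that ∫_{ℝ^n} x_i x_j u(x)² dγ_n(x) = δ_{ij} · ‖u‖_{L_2(γ_n)}² for all i, j ∈ {1,…,n}, where δ_{ij} is the Kronecker delta. Then for every p ∈ [1,2): ( ‖u‖_{L_2(γ_n)}² − ‖u‖_{L_p(γ_n)}² ) / ‖u‖_{L_2(γ_n)}² ≤ 1 − [ det( (4/‖u‖_{L_2(γ_n)}²) ∫_{ℝ^n} (∇u)^{⊗2} dγ_n + Id_n ) ]^{−(2−p)/(2p)}. -/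

import Mathlib

open MeasureTheory

/-- The `k`-th partial derivative of a function on `ℝⁿ`. -/
noncomputable def pderiv' {n : ℕ} (f : (Fin n → ℝ) → ℝ) (k : Fin n) (x : Fin n → ℝ) : ℝ :=
  fderiv ℝ f x (Pi.single k 1)

/-- The standard Gaussian measure `γₙ` on `ℝⁿ`. -/
noncomputable def stdGauss (n : ℕ) : Measure (Fin n → ℝ) :=
  volume.withDensity fun x =>
    ENNReal.ofReal ((2 * Real.pi) ^ (-(n : ℝ) / 2) * Real.exp (-(∑ i, x i ^ 2) / 2))

/-- The primitive of a continuous function bounded below by a positive constant has a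
differentiable inverse. -/
lemma exists_inverse_primitive {ρ : ℝ → ℝ} (hρ : Continuous ρ) {c : ℝ} (hc : 0 < c)
    (hcρ : ∀ y, c ≤ ρ y) (a : ℝ) :
    ∃ S : ℝ → ℝ, (∀ y, S (∫ t in a..y, ρ t) = y) ∧
      ∀ z, HasDerivAt S (ρ (S z))⁻¹ z := by
  set G : ℝ → ℝ := fun y => ∫ t in a..y, ρ t with hG
  have hGd : ∀ y, HasDerivAt G (ρ y) y := fun y => hρ.integral_hasStrictDerivAt a y |>.hasDerivAt
  have hpos : ∀ y, 0 < ρ y := fun y => hc.trans_le (hcρ y)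
  have hmono : StrictMono G := strictMono_of_deriv_pos fun y => by
    rw [(hGd y).deriv]; exact hpos y
  have hcont : Continuous G := continuous_iff_continuousAt.2 fun y => (hGd y).continuousAt
  have hlin : Monotone fun y => G y - c * y := monotone_of_deriv_nonneg
    (fun y => ((hGd y).sub ((hasDerivAt_id y).const_mul c)).differentiableAt) fun y => by
      have := ((hGd y).sub ((hasDerivAt_id y).const_mul c)).deriv
      simp only [id, mul_one] at this
      erw [this]; linarith [hcρ y]
  have hsurj : Function.Surjective G := by
    apply hcont.surjective
    · refine Filter.tendsto_atTop_mono' _ ?_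
        (Filter.tendsto_atTop_add_const_left _ (G 0)
          (Filter.tendsto_id.const_mul_atTop hc))
      filter_upwards [Filter.eventually_ge_atTop 0] with y hy
      have := hlin hy
      simp only [id] at *; linarith
    · refine Filter.tendsto_atBot_mono' _ ?_
        (Filter.tendsto_atBot_add_const_left _ (G 0)
          (Filter.tendsto_id.const_mul_atBot hc))
      filter_upwards [Filter.eventually_le_atBot 0] with y hy
      have := hlin hy
      simp only [id] at *; linarith
  let e := hmono.orderIsoOfSurjective G hsurj
  have hes : ∀ z, G (e.symm z) = z := fun z => hmono.orderIsoOfSurjective_self_symm_apply G hsurj z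
  refine ⟨e.symm,
    fun y => hmono.orderIsoOfSurjective_symm_apply_self G hsurj y, fun z => ?_⟩
  exact HasDerivAt.of_local_left_inverse e.symm.continuous.continuousAt (hGd _) (hpos _).ne'
    (Filter.Eventually.of_forall hes)

/-- A monotone map of `[-R, R]` transporting a positive density to a multiple of the truncated
Gaussian density. -/
lemma exists_gaussian_transport {R : ℝ} (hR : 0 < R) {g : ℝ → ℝ} (hg : Continuous g)
    (hg0 : ∀ x, 0 < g x) :
    ∃ T T' : ℝ → ℝ, T (-R) = -R ∧ T R = R ∧ Continuous T' ∧ (∀ x, HasDerivAt T (T' x) x) ∧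
      (∀ x, 0 < T' x) ∧ ∀ x ∈ Set.Icc (-R) R,
        g x = (∫ t in (-R)..R, g t) / (∫ t in (-R)..R, Real.exp (-t ^ 2 / 2)) *
          Real.exp (-(T x) ^ 2 / 2) * T' x := by
  set ρ : ℝ → ℝ := fun y => max (Real.exp (-y ^ 2 / 2)) (Real.exp (-R ^ 2 / 2)) with hρdef
  have hρ : Continuous ρ := by fun_prop
  have hρpos : ∀ y, 0 < ρ y := fun y => lt_max_of_lt_left (Real.exp_pos _)
  have hρeq : ∀ y ∈ Set.Icc (-R) R, ρ y = Real.exp (-y ^ 2 / 2) := by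
    intro y hy
    apply max_eq_left
    apply Real.exp_le_exp.2
    have := sq_le_sq' hy.1 hy.2
    linarith
  obtain ⟨S, hSG, hSd⟩ := exists_inverse_primitive hρ (Real.exp_pos (-R ^ 2 / 2))
    (fun y => le_max_right _ _) (-R)
  set a := ∫ t in (-R)..R, Real.exp (-t ^ 2 / 2) with ha
  set μ := ∫ t in (-R)..R, g t with hμ
  have hRR : -R < R := by linarith
  have ha0 : 0 < a := intervalIntegral.intervalIntegral_pos_of_pos
    (Continuous.intervalIntegrable (by fun_prop) _ _) (fun _ => Real.exp_pos _) hRR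
  have hμ0 : 0 < μ := intervalIntegral.intervalIntegral_pos_of_pos
    (hg.intervalIntegrable _ _) hg0 hRR
  have haρ : ∫ t in (-R)..R, ρ t = a := intervalIntegral.integral_congr fun t ht => by
    rw [Set.uIcc_of_le hRR.le] at ht
    exact hρeq t ht
  have hFd : ∀ x, HasDerivAt (fun x => a / μ * ∫ t in (-R)..x, g t) (a / μ * g x) x := fun x =>
    (hg.integral_hasStrictDerivAt (-R) x).hasDerivAt.const_mul _
  set T : ℝ → ℝ := fun x => S (a / μ * ∫ t in (-R)..x, g t) with hT
  have hTd : ∀ x, HasDerivAt T ((ρ (T x))⁻¹ * (a / μ * g x)) x := fun x =>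
    (hSd _).comp x (hFd x)
  have hTc : Continuous T := continuous_iff_continuousAt.2 fun x => (hTd x).continuousAt
  have hT'pos : ∀ x, 0 < (ρ (T x))⁻¹ * (a / μ * g x) := fun x =>
    mul_pos (inv_pos.2 (hρpos _)) (mul_pos (div_pos ha0 hμ0) (hg0 x))
  have hTm : StrictMono T := strictMono_of_deriv_pos fun x => by
    rw [(hTd x).deriv]; exact hT'pos x
  have hTl : T (-R) = -R := by
    have := hSG (-R)
    simp only [intervalIntegral.integral_same] at this
    simp [hT, this]
  have hTr : T R = R := by
    have := hSG R
    rw [haρ] at this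
    simp only [hT]
    rw [← hμ, div_mul_cancel₀ _ hμ0.ne', this]
  refine ⟨T, fun x => (ρ (T x))⁻¹ * (a / μ * g x), hTl, hTr, ?_, hTd, hT'pos, ?_⟩
  · exact ((hρ.comp hTc).inv₀ fun x => (hρpos _).ne').mul (hg.const_mul _)
  · intro x hx
    have hTx : T x ∈ Set.Icc (-R) R :=
      ⟨hTl.ge.trans (hTm.monotone hx.1), (hTm.monotone hx.2).trans hTr.le⟩
    dsimp only
    rw [hρeq _ hTx]
    have := (Real.exp_pos (-(T x) ^ 2 / 2)).ne'
    field_simp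

/-- The logarithmic Sobolev inequality on `[-R, R]`, for a positive density. -/
lemma logSobolev_interval_of_pos {R : ℝ} (hR : 0 < R) {g g' k : ℝ → ℝ} (hg0 : ∀ x, 0 < g x)
    (hgd : ∀ x, HasDerivAt g (g' x) x) (hg' : Continuous g')
    (hk : IntervalIntegrable k volume (-R) R) (hk0 : ∀ x, 0 ≤ k x)
    (hgk : ∀ x, g' x ^ 2 ≤ 4 * g x * k x) :
    ∫ x in (-R)..R, g x * Real.log (g x) ≤
      R * (g R + g (-R)) + 2 * (∫ x in (-R)..R, k x) - (∫ x in (-R)..R, g x)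
        + (∫ x in (-R)..R, g x) * Real.log (∫ x in (-R)..R, g x)
        - (∫ x in (-R)..R, g x) * Real.log (∫ t in (-R)..R, Real.exp (-t ^ 2 / 2)) := by
  have hg : Continuous g := continuous_iff_continuousAt.2 fun x => (hgd x).continuousAt
  obtain ⟨T, T', hTl, hTr, hT'c, hTd, hT'0, hTeq⟩ := exists_gaussian_transport hR hg hg0
  have hTc : Continuous T := continuous_iff_continuousAt.2 fun x => (hTd x).continuousAt
  set a := ∫ t in (-R)..R, Real.exp (-t ^ 2 / 2) with ha
  set μ := ∫ t in (-R)..R, g t with hμ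
  have hRR : -R < R := by linarith
  have ha0 : 0 < a := intervalIntegral.intervalIntegral_pos_of_pos
    (Continuous.intervalIntegrable (by fun_prop) _ _) (fun _ => Real.exp_pos _) hRR
  have hμ0 : 0 < μ := intervalIntegral.intervalIntegral_pos_of_pos
    (hg.intervalIntegrable _ _) hg0 hRR
  have hibp := intervalIntegral.integral_mul_deriv_eq_deriv_mul
    (a := -R) (b := R) (u := g) (v := T) (fun x _ => hgd x) (fun x _ => hTd x)
    (hg'.intervalIntegrable _ _) (hT'c.intervalIntegrable _ _)
  rw [hTl, hTr] at hibp
  have hpt : ∀ x ∈ Set.Icc (-R) R, g x * Real.log (g x) ≤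
      g x * T' x + g' x * T x + 2 * k x + (Real.log μ - Real.log a - 1) * g x := by
    intro x hx
    have hlog : Real.log (g x) = Real.log μ - Real.log a - (T x) ^ 2 / 2 + Real.log (T' x) := by
      conv_lhs => rw [hTeq x hx]
      rw [Real.log_mul (by have := Real.exp_pos (-(T x) ^ 2 / 2); positivity) (hT'0 x).ne',
        Real.log_mul (by positivity) (Real.exp_pos _).ne', Real.log_div hμ0.ne' ha0.ne',
        Real.log_exp]
      ring
    have h1 : g x * Real.log (T' x) ≤ g x * (T' x - 1) :=
      mul_le_mul_of_nonneg_left (Real.log_le_sub_one_of_pos (hT'0 x)) (hg0 x).le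
    have h2 : -(g' x * T x) ≤ 2 * k x + g x * T x ^ 2 / 2 := by
      have hb : 0 ≤ 2 * k x + g x * T x ^ 2 / 2 := by
        have := hk0 x; have := (hg0 x).le; positivity
      apply le_of_abs_le
      apply abs_le_of_sq_le_sq _ hb
      have := mul_le_mul_of_nonneg_right (hgk x) (sq_nonneg (T x))
      nlinarith [sq_nonneg (2 * k x - g x * T x ^ 2 / 2)]
    rw [hlog]
    nlinarith
  have hi1 : IntervalIntegrable (fun x => g x * T' x) volume (-R) R :=
    (hg.mul hT'c).intervalIntegrable _ _
  have hi2 : IntervalIntegrable (fun x => g' x * T x) volume (-R) R :=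
    (hg'.mul hTc).intervalIntegrable _ _
  have hi3 : IntervalIntegrable (fun x => (Real.log μ - Real.log a - 1) * g x) volume (-R) R :=
    (hg.const_mul _).intervalIntegrable _ _
  have hmain := intervalIntegral.integral_mono_on hRR.le
    ((hg.mul (hg.log fun x => (hg0 x).ne')).intervalIntegrable _ _)
    (((hi1.add hi2).add (hk.const_mul 2)).add hi3) hpt
  rw [intervalIntegral.integral_add ((hi1.add hi2).add (hk.const_mul 2)) hi3,
    intervalIntegral.integral_add (hi1.add hi2) (hk.const_mul 2),
    intervalIntegral.integral_add hi1 hi2, hibp, intervalIntegral.integral_const_mul,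
    intervalIntegral.integral_const_mul, ← hμ] at hmain
  refine hmain.trans (le_of_eq ?_)
  ring

/-- The logarithmic Sobolev inequality on the line for the Lebesgue measure. -/
lemma logSobolev_real {f f' k : ℝ → ℝ} (hf0 : ∀ x, 0 ≤ f x) (hfs : HasCompactSupport f)
    (hfd : ∀ x, HasDerivAt f (f' x) x) (hf' : Continuous f')
    (hk : Integrable k) (hk0 : ∀ x, 0 ≤ k x) (hfk : ∀ x, f' x ^ 2 ≤ 4 * f x * k x) :
    ∫ x, f x * Real.log (f x) ≤
      (∫ x, f x) * Real.log (∫ x, f x) + 2 * (∫ x, k x)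
        - (1 + Real.log (2 * Real.pi) / 2) * ∫ x, f x := by
  have hf : Continuous f := continuous_iff_continuousAt.2 fun x => (hfd x).continuousAt
  have hfi : Integrable f := hf.integrable_of_hasCompactSupport hfs
  have hφc : Continuous fun x => f x * Real.log (f x) := Real.continuous_mul_log.comp hf
  have hφi : Integrable fun x => f x * Real.log (f x) :=
    hφc.integrable_of_hasCompactSupport (hfs.comp_left (g := fun t => t * Real.log t) (by simp))
  have hgi : Integrable fun t : ℝ => Real.exp (-t ^ 2 / 2) := by
    refine (integrable_exp_neg_mul_sq (b := 1 / 2) (by norm_num)).congr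
      (Filter.Eventually.of_forall fun t => ?_)
    dsimp only; congr 1; ring
  have hgv : ∫ t : ℝ, Real.exp (-t ^ 2 / 2) = √(2 * Real.pi) := by
    have := integral_gaussian (1 / 2)
    rw [show Real.pi / (1 / 2) = 2 * Real.pi by ring] at this
    rw [← this]
    congr 1; ext t; congr 1; ring
  obtain ⟨r, hr⟩ := hfs.isCompact.isBounded.subset_closedBall (0 : ℝ)
  have hfr : ∀ x, r < |x| → f x = 0 := by
    intro x hx
    by_contra h
    have := hr (subset_tsupport f h)
    rw [mem_closedBall_zero_iff, Real.norm_eq_abs] at this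
    linarith
  have hfin : ∀ R, 0 < R → r < R → ∫ x in (-R)..R, f x * Real.log (f x) ≤
      2 * (∫ x in (-R)..R, k x) - (∫ x in (-R)..R, f x)
        + (∫ x in (-R)..R, f x) * Real.log (∫ x in (-R)..R, f x)
        - (∫ x in (-R)..R, f x) * Real.log (∫ t in (-R)..R, Real.exp (-t ^ 2 / 2)) := by
    intro R hR hrR
    have hfR : f R = 0 := hfr R (by rwa [abs_of_pos hR])
    have hfR' : f (-R) = 0 := hfr (-R) (by rwa [abs_neg, abs_of_pos hR])
    have hmass : Continuous fun ε : ℝ => ∫ x in (-R)..R, (f x + ε) :=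
      intervalIntegral.continuous_parametric_intervalIntegral_of_continuous'
        (f := fun ε x => f x + ε) (by unfold Function.uncurry; fun_prop) _ _
    have hL : Continuous fun ε : ℝ => ∫ x in (-R)..R, (f x + ε) * Real.log (f x + ε) :=
      intervalIntegral.continuous_parametric_intervalIntegral_of_continuous'
        (f := fun ε x => (f x + ε) * Real.log (f x + ε))
        (Real.continuous_mul_log.comp (by fun_prop : Continuous fun p : ℝ × ℝ => f p.2 + p.1)) _ _
    have hRc : Continuous fun ε : ℝ => R * (2 * ε) + 2 * (∫ x in (-R)..R, k x)
        - (∫ x in (-R)..R, (f x + ε))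
        + (∫ x in (-R)..R, (f x + ε)) * Real.log (∫ x in (-R)..R, (f x + ε))
        - (∫ x in (-R)..R, (f x + ε)) * Real.log (∫ t in (-R)..R, Real.exp (-t ^ 2 / 2)) := by
      have := Real.continuous_mul_log.comp hmass
      simp only [Function.comp_def] at this
      fun_prop
    have key : ∀ ε : ℝ, 0 < ε → _ ≤ _ := fun ε hε =>
      logSobolev_interval_of_pos hR (g := fun x => f x + ε) (g' := f') (k := k)
        (fun x => by linarith [hf0 x]) (fun x => (hfd x).add_const ε) hf' hk.intervalIntegrable hk0
        (fun x => (hfk x).trans (by nlinarith [mul_nonneg hε.le (hk0 x)]))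
    have := le_of_tendsto_of_tendsto
      ((hL.tendsto 0).mono_left (nhdsWithin_le_nhds (s := Set.Ioi 0)))
      ((hRc.tendsto 0).mono_left (nhdsWithin_le_nhds (s := Set.Ioi 0)))
      (by
        filter_upwards [self_mem_nhdsWithin] with ε hε
        have := key ε hε
        simp only [hfR, hfR', zero_add, ← two_mul] at this
        exact this)
    simpa using this
  have hlim : ∀ {h : ℝ → ℝ}, Integrable h → Filter.Tendsto (fun R => ∫ x in (-R)..R, h x)
      Filter.atTop (nhds (∫ x, h x)) := fun hh =>
    intervalIntegral_tendsto_integral hh Filter.tendsto_neg_atTop_atBot Filter.tendsto_id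
  have hlog : Filter.Tendsto (fun R => Real.log (∫ t in (-R)..R, Real.exp (-t ^ 2 / 2)))
      Filter.atTop (nhds (Real.log (2 * Real.pi) / 2)) := by
    rw [← Real.log_sqrt (by positivity), ← hgv]
    apply (hlim hgi).log
    rw [hgv]; positivity
  have := le_of_tendsto_of_tendsto (hlim hφi)
    (((((hlim hk).const_mul 2).sub (hlim hfi)).add
      ((Real.continuous_mul_log.tendsto _).comp (hlim hfi))).sub ((hlim hfi).mul hlog))
    (by
      filter_upwards [Filter.eventually_gt_atTop 0, Filter.eventually_gt_atTop r] with R h1 h2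
      exact hfin R h1 h2)
  refine this.trans (le_of_eq ?_)
  ring

/-- Differentiation under the integral sign for compactly supported functions on a product. -/
lemma hasDerivAt_integral_of_hasCompactSupport {n : ℕ} {F F' : ℝ × (Fin n → ℝ) → ℝ}
    (hF : Continuous F) (hFs : HasCompactSupport F) (hF' : Continuous F')
    (hFs' : HasCompactSupport F')
    (hd : ∀ x y, HasDerivAt (fun t => F (t, y)) (F' (x, y)) x) :
    (∀ x, HasDerivAt (fun x => ∫ y, F (x, y)) (∫ y, F' (x, y)) x) ∧
      Continuous fun x => ∫ y, F' (x, y) := by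
  obtain ⟨C, hC⟩ := hF'.bounded_above_of_compact_support hFs'
  set K : Set (Fin n → ℝ) := Prod.snd '' tsupport F' with hK
  have hKc : IsCompact K := hFs'.isCompact.image continuous_snd
  have hzero : ∀ x y, y ∉ K → F' (x, y) = 0 := by
    intro x y hy
    by_contra h
    exact hy ⟨(x, y), subset_tsupport _ h, rfl⟩
  have hbound : ∀ x y, ‖F' (x, y)‖ ≤ K.indicator (fun _ => C) y := by
    intro x y
    by_cases hy : y ∈ K
    · rw [Set.indicator_of_mem hy]; exact hC _
    · rw [Set.indicator_of_notMem hy, hzero x y hy, norm_zero]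
  have hint : Integrable (K.indicator fun _ : Fin n → ℝ => C) :=
    (integrableOn_const hKc.measure_ne_top).integrable_indicator hKc.measurableSet
  have hslice : ∀ x, HasCompactSupport fun y => F (x, y) := fun x =>
    HasCompactSupport.intro (hFs.isCompact.image continuous_snd) fun y hy => by
      by_contra h
      exact hy ⟨(x, y), subset_tsupport _ h, rfl⟩
  refine ⟨fun x => (hasDerivAt_integral_of_dominated_loc_of_deriv_le (s := Set.univ)
    (F := fun x y => F (x, y)) (F' := fun x y => F' (x, y)) Filter.univ_mem
    (Filter.Eventually.of_forall fun x => Continuous.aestronglyMeasurable (by fun_prop))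
    (Continuous.integrable_of_hasCompactSupport (by fun_prop) (hslice x))
    (Continuous.aestronglyMeasurable (by fun_prop))
    (Filter.Eventually.of_forall fun y x _ => hbound x y) hint
    (Filter.Eventually.of_forall fun y x _ => hd x y)).2, ?_⟩
  exact continuous_of_dominated (fun x => Continuous.aestronglyMeasurable (by fun_prop))
    (fun x => Filter.Eventually.of_forall fun y => hbound x y) hint
    (Filter.Eventually.of_forall fun y => by fun_prop)

/-- The Cauchy–Schwarz inequality for integrals of real functions. -/
lemma sq_integral_mul_le {α : Type*} [MeasurableSpace α] {μ : Measure α} {f g : α → ℝ}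
    (hf : Integrable (fun x => f x ^ 2) μ) (hg : Integrable (fun x => g x ^ 2) μ)
    (hfg : Integrable (fun x => f x * g x) μ) :
    (∫ x, f x * g x ∂μ) ^ 2 ≤ (∫ x, f x ^ 2 ∂μ) * ∫ x, g x ^ 2 ∂μ := by
  have h : ∀ t : ℝ, 0 ≤ (∫ x, f x ^ 2 ∂μ) * (t * t) + (2 * ∫ x, f x * g x ∂μ) * t
      + ∫ x, g x ^ 2 ∂μ := by
    intro t
    have h0 : 0 ≤ ∫ x, (f x * t + g x) ^ 2 ∂μ := integral_nonneg fun x => sq_nonneg _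
    have h1 : ∫ x, (f x * t + g x) ^ 2 ∂μ =
        ∫ x, (f x ^ 2 * (t * t) + (f x * g x) * (2 * t) + g x ^ 2) ∂μ :=
      integral_congr_ae (Filter.Eventually.of_forall fun x => by ring)
    rw [h1, integral_add ((hf.mul_const _).fun_add (hfg.mul_const _)) hg,
      integral_add (hf.mul_const _) (hfg.mul_const _), integral_mul_const,
      integral_mul_const] at h0
    linarith
  have := discrim_le_zero h
  rw [discrim] at this
  nlinarith

/-- The logarithmic Sobolev inequality on a product, given one for the second factor. -/
lemma logSobolev_prod {n : ℕ} {C : ℝ} {w wx : ℝ × (Fin n → ℝ) → ℝ} {D : ℝ × (Fin n → ℝ) → ℝ}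
    (hw : Continuous w) (hws : HasCompactSupport w)
    (hwx : Continuous wx) (hwxs : HasCompactSupport wx)
    (hd : ∀ x y, HasDerivAt (fun t => w (t, y)) (wx (x, y)) x)
    (hD : Continuous D) (hDs : HasCompactSupport D)
    (hslice : ∀ x, ∫ y, w (x, y) ^ 2 * Real.log (w (x, y) ^ 2) ≤
      (∫ y, w (x, y) ^ 2) * Real.log (∫ y, w (x, y) ^ 2) + 2 * (∫ y, D (x, y))
        - C * ∫ y, w (x, y) ^ 2) :
    ∫ z, w z ^ 2 * Real.log (w z ^ 2) ≤
      (∫ z, w z ^ 2) * Real.log (∫ z, w z ^ 2) + 2 * ((∫ z, wx z ^ 2) + ∫ z, D z)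
        - (1 + Real.log (2 * Real.pi) / 2 + C) * ∫ z, w z ^ 2 := by
  have sqs : ∀ {v : ℝ × (Fin n → ℝ) → ℝ}, HasCompactSupport v → HasCompactSupport fun z => v z ^ 2 :=
    fun hv => hv.comp_left (g := fun t => t ^ 2) (by simp)
  have hw2i : Integrable fun z => w z ^ 2 :=
    (hw.pow 2).integrable_of_hasCompactSupport (sqs hws)
  have hwx2i : Integrable fun z => wx z ^ 2 :=
    (hwx.pow 2).integrable_of_hasCompactSupport (sqs hwxs)
  have hDi : Integrable D := hD.integrable_of_hasCompactSupport hDs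
  have hφi : Integrable fun z => w z ^ 2 * Real.log (w z ^ 2) :=
    (Real.continuous_mul_log.comp (hw.pow 2)).integrable_of_hasCompactSupport
      ((sqs hws).comp_left (g := fun t => t * Real.log t) (by simp))
  have slice_i : ∀ {v : ℝ × (Fin n → ℝ) → ℝ}, Continuous v → HasCompactSupport v →
      ∀ x, Integrable fun y => v (x, y) := fun {v} hv hvs x =>
    Continuous.integrable_of_hasCompactSupport (by fun_prop)
      (HasCompactSupport.intro (hvs.isCompact.image continuous_snd) fun y hy => by
        by_contra h
        exact hy ⟨(x, y), subset_tsupport _ h, rfl⟩)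
  obtain ⟨hmd, hmc⟩ := hasDerivAt_integral_of_hasCompactSupport
    (F := fun z => w z ^ 2) (F' := fun z => 2 * (w z * wx z)) (hw.pow 2) (sqs hws)
    (by fun_prop) ((hws.mul_right (f' := wx)).comp_left (g := fun t => 2 * t) (by simp))
    (fun x y => ((hd x y).pow 2).congr_deriv (by simp; ring))
  have hms : HasCompactSupport fun x => ∫ y, w (x, y) ^ 2 :=
    HasCompactSupport.intro (hws.isCompact.image continuous_fst) fun x hx => by
      have : ∀ y, w (x, y) = 0 := fun y => by
        by_contra h
        exact hx ⟨(x, y), subset_tsupport _ h, rfl⟩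
      simp [this]
  have h1 := logSobolev_real (f := fun x => ∫ y, w (x, y) ^ 2)
    (k := fun x => ∫ y, wx (x, y) ^ 2) (fun x => integral_nonneg fun y => sq_nonneg _) hms hmd hmc
    hwx2i.integral_prod_left (fun x => integral_nonneg fun y => sq_nonneg _)
    (fun x => by
      rw [integral_const_mul]
      have := sq_integral_mul_le (slice_i (hw.pow 2) (sqs hws) x)
        (slice_i (hwx.pow 2) (sqs hwxs) x) (slice_i (hw.mul hwx) (hws.mul_right (f' := wx)) x)
      nlinarith)
  have hmcont : Continuous fun x => ∫ y, w (x, y) ^ 2 :=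
    continuous_iff_continuousAt.2 fun x => (hmd x).continuousAt
  have hmi : Integrable fun x =>
      (∫ y, w (x, y) ^ 2) * Real.log (∫ y, w (x, y) ^ 2) :=
    (Real.continuous_mul_log.comp hmcont).integrable_of_hasCompactSupport
      (hms.comp_left (g := fun t => t * Real.log t) (by simp))
  have h2 := integral_mono hφi.integral_prod_left
    ((hmi.fun_add (hDi.integral_prod_left.const_mul 2)).sub (hw2i.integral_prod_left.const_mul C))
    hslice
  simp only [Pi.sub_apply] at h2
  rw [integral_sub (hmi.fun_add (hDi.integral_prod_left.const_mul 2))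
    (hw2i.integral_prod_left.const_mul C), integral_add hmi (hDi.integral_prod_left.const_mul 2),
    integral_const_mul, integral_const_mul] at h2
  have e1 := integral_prod _ hw2i
  have e2 := integral_prod _ hwx2i
  have e3 := integral_prod _ hDi
  have e4 := integral_prod _ hφi
  rw [← e1, ← e2] at h1
  rw [← Measure.volume_eq_prod] at *
  rw [← e1, ← e3, ← e4] at h2
  linarith

/-- The logarithmic Sobolev inequality on `ℝⁿ` for the Lebesgue measure. -/
lemma logSobolev_pi (n : ℕ) : ∀ {w : (Fin n → ℝ) → ℝ}, ContDiff ℝ 1 w → HasCompactSupport w →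
    ∫ x, w x ^ 2 * Real.log (w x ^ 2) ≤
      (∫ x, w x ^ 2) * Real.log (∫ x, w x ^ 2) + 2 * (∑ i, ∫ x, pderiv' w i x ^ 2)
        - (n * (1 + Real.log (2 * Real.pi) / 2)) * ∫ x, w x ^ 2 := by
  induction n with
  | zero =>
    intro w _ _
    have : (volume : Measure (Fin 0 → ℝ)).real Set.univ = 1 := by
      simp [Measure.real, volume_pi]
    simp [integral_unique, this]
  | succ n ih =>
    intro w hw hws
    obtain ⟨L, hL⟩ : ∃ L : (ℝ × (Fin n → ℝ)) ≃L[ℝ] (Fin (n + 1) → ℝ),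
        ∀ z, L z = Fin.cons z.1 z.2 :=
      ⟨Fin.consEquivL ℝ (fun _ : Fin (n + 1) => ℝ), fun _ => rfl⟩
    have hLmp : MeasurePreserving (fun z : ℝ × (Fin n → ℝ) => L z) := by
      convert (volume_preserving_piFinSuccAbove (fun _ : Fin (n + 1) => ℝ) 0).symm _ using 1
      ext z i : 2
      simp [hL, MeasurableEquiv.piFinSuccAbove, Fin.insertNthEquiv]
    have hLint : ∀ g : (Fin (n + 1) → ℝ) → ℝ, ∫ z, g (L z) = ∫ x, g x := fun g =>
      hLmp.integral_comp L.toHomeomorph.measurableEmbedding g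
    have hwd : ∀ x, HasFDerivAt w (fderiv ℝ w x) x := fun x =>
      (hw.differentiable one_ne_zero x).hasFDerivAt
    have hpc : ∀ i, Continuous fun x => pderiv' w i x := fun i =>
      (hw.continuous_fderiv one_ne_zero).clm_apply continuous_const
    have hps : ∀ i, HasCompactSupport fun x => pderiv' w i x := fun i =>
      hws.fderiv_apply ℝ _
    have hps2 : ∀ i, HasCompactSupport fun x => pderiv' w i x ^ 2 := fun i =>
      (hps i).comp_left (g := fun t => t ^ 2) (by simp)
    have hcomp : ∀ {g : (Fin (n + 1) → ℝ) → ℝ}, HasCompactSupport g →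
        HasCompactSupport fun z => g (L z) := fun hg =>
      hg.comp_homeomorph L.toHomeomorph
    have hslice : ∀ {g : (Fin (n + 1) → ℝ) → ℝ}, HasCompactSupport g →
        ∀ x, HasCompactSupport fun y => g (L (x, y)) := fun {g} hg x =>
      HasCompactSupport.intro ((hcomp hg).isCompact.image continuous_snd) fun y hy => by
        by_contra h
        exact hy ⟨(x, y), subset_tsupport (fun z => g (L z)) h, rfl⟩
    have hsl : ∀ x y (i : Fin n), pderiv' (fun y => w (L (x, y))) i y
        = pderiv' w i.succ (L (x, y)) := by
      intro x y i
      have : HasFDerivAt (fun y => w (L (x, y))) _ y :=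
        (hwd (L (x, y))).comp y (L.hasFDerivAt.comp y (hasFDerivAt_prodMk_right x y))
      rw [pderiv', this.fderiv, pderiv']
      simp only [ContinuousLinearMap.comp_apply]
      congr 1
      ext j
      refine Fin.cases ?_ (fun j => ?_) j
      · simp [hL]
      · simp [hL, Pi.single_apply]
    have hDi : ∀ (i : Fin n) x, Integrable fun y => pderiv' w i.succ (L (x, y)) ^ 2 :=
      fun i x => Continuous.integrable_of_hasCompactSupport
        (by have := hpc i.succ; fun_prop) (hslice (hps2 i.succ) x)
    have hDi' : ∀ i : Fin n, Integrable fun z => pderiv' w i.succ (L z) ^ 2 := fun i =>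
      Continuous.integrable_of_hasCompactSupport
        (((hpc i.succ).comp L.continuous).pow 2)
        (hcomp (g := fun x => pderiv' w i.succ x ^ 2) (hps2 i.succ))
    have hprod := logSobolev_prod (C := n * (1 + Real.log (2 * Real.pi) / 2))
      (w := fun z => w (L z)) (wx := fun z => pderiv' w 0 (L z))
      (D := fun z => ∑ i : Fin n, pderiv' w i.succ (L z) ^ 2)
      (by have := hw.continuous; fun_prop) (hcomp hws)
      ((hpc 0).comp L.continuous) (hcomp (hps 0))
      (fun x y => by
        have := (hwd (L (x, y))).comp_hasDerivAt x (L.hasFDerivAt.comp_hasDerivAt x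
          ((hasDerivAt_id x).prodMk (hasDerivAt_const x y)))
        refine this.congr_deriv ?_
        rw [pderiv']
        congr 1
        ext j
        refine Fin.cases ?_ (fun j => ?_) j
        · simp [hL]
        · simp [hL])
      (continuous_finsetSum _ fun i _ => ((hpc i.succ).comp L.continuous).pow 2)
      (hcomp (g := fun x => ∑ i : Fin n, pderiv' w i.succ x ^ 2)
        (HasCompactSupport.intro hws.isCompact fun x hx => by
          have : fderiv ℝ w x = 0 := by
            by_contra h
            exact hx (support_fderiv_subset ℝ h)
          simp [pderiv', this]))
      (fun x => by
        have := ih (w := fun y => w (L (x, y)))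
          (hw.comp (L.contDiff.comp (contDiff_const.prodMk contDiff_id))) (hslice hws x)
        simp only [hsl] at this
        rwa [← integral_finsetSum _ fun i _ => hDi i x] at this)
    rw [integral_finsetSum _ fun i _ => hDi' i,
      hLint (fun x => w x ^ 2), hLint (fun x => w x ^ 2 * Real.log (w x ^ 2)),
      hLint (fun x => pderiv' w 0 x ^ 2)] at hprod
    simp only [fun i : Fin n => hLint (fun x => pderiv' w i.succ x ^ 2)] at hprod
    rw [Fin.sum_univ_succ]
    push_cast
    linarith

lemma fderiv_apply_eq_sum_pderiv' {n : ℕ} (w : (Fin n → ℝ) → ℝ) (x v : Fin n → ℝ) :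
    fderiv ℝ w x v = ∑ j, v j * pderiv' w j x := by
  have := LinearMap.pi_apply_eq_sum_univ (fderiv ℝ w x).toLinearMap v
  simp only [ContinuousLinearMap.coe_coe, smul_eq_mul] at this
  rw [this]
  refine Finset.sum_congr rfl fun j _ => ?_
  rw [pderiv']
  congr 2
  ext k
  simp [Pi.single_apply, eq_comm]

lemma integral_comp_mulVec {n : ℕ} {A : Matrix (Fin n) (Fin n) ℝ} (hA : A.det ≠ 0)
    {g : (Fin n → ℝ) → ℝ} (hg : Continuous g) :
    ∫ x, g (A.mulVec x) = |A.det|⁻¹ * ∫ x, g x := by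
  have h := Real.map_matrix_volume_pi_eq_smul_volume_pi hA
  have hm : Measurable (Matrix.toLin' A) :=
    (LinearMap.continuous_of_finiteDimensional _).measurable
  have := integral_map hm.aemeasurable (μ := volume) (f := g) hg.aestronglyMeasurable
  rw [h, integral_smul_measure, ENNReal.toReal_ofReal (abs_nonneg _), abs_inv, smul_eq_mul] at this
  simpa [Matrix.toLin'_apply] using this.symm

/-- The logarithmic Sobolev inequality on `ℝⁿ` in terms of the determinant of the Fisher
information matrix. -/
lemma logSobolev_det {n : ℕ} {w : (Fin n → ℝ) → ℝ} (hw : ContDiff ℝ 1 w)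
    (hws : HasCompactSupport w) (hm : 0 < ∫ x, w x ^ 2) {M : Matrix (Fin n) (Fin n) ℝ}
    (hM : M.PosDef)
    (hMw : ∀ i j, ∫ x, pderiv' w i x * pderiv' w j x = (∫ x, w x ^ 2) / 4 * M i j) :
    ∫ x, w x ^ 2 * Real.log (w x ^ 2) ≤
      (∫ x, w x ^ 2) * (Real.log (∫ x, w x ^ 2) + Real.log M.det / 2
        - n / 2 * (1 + Real.log (2 * Real.pi))) := by
  set m := ∫ x, w x ^ 2 with hmdef
  obtain ⟨B, hB⟩ : ∃ B : Matrix (Fin n) (Fin n) ℝ, M = B.transpose * B := by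
    open scoped MatrixOrder in
    obtain ⟨B, hB⟩ := CStarAlgebra.nonneg_iff_eq_star_mul_self.mp hM.posSemidef.nonneg
    exact ⟨B, by simpa [Matrix.star_eq_conjTranspose] using hB⟩
  have hdetM : M.det = B.det ^ 2 := by
    rw [hB, Matrix.det_mul, Matrix.det_transpose, sq]
  have hBdet : B.det ≠ 0 := by
    intro h
    have := hM.det_pos
    rw [hdetM, h] at this
    simp at this
  have hBu : IsUnit B.det := isUnit_iff_ne_zero.2 hBdet
  set A := B⁻¹ with hAdef
  have hAB : A * B = 1 := Matrix.nonsing_inv_mul B hBu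
  have hBA : B * A = 1 := Matrix.mul_nonsing_inv B hBu
  have hAdet : A.det = B.det⁻¹ := by rw [hAdef, Matrix.det_nonsing_inv, Ring.inverse_eq_inv']
  have hAdet0 : A.det ≠ 0 := by rw [hAdet]; exact inv_ne_zero hBdet
  obtain ⟨L, hL⟩ : ∃ L : (Fin n → ℝ) ≃L[ℝ] (Fin n → ℝ), ∀ x, L x = A.mulVec x :=
    ⟨(Matrix.toLin'OfInv hBA hAB).toContinuousLinearEquiv, fun _ => rfl⟩
  have hpc : ∀ i, Continuous fun x => pderiv' w i x := fun i =>
    (hw.continuous_fderiv one_ne_zero).clm_apply continuous_const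
  have hps : ∀ i, HasCompactSupport fun x => pderiv' w i x := fun i => hws.fderiv_apply ℝ _
  have hpi : ∀ i j, Integrable fun x => pderiv' w i x * pderiv' w j x := fun i j =>
    ((hpc i).mul (hpc j)).integrable_of_hasCompactSupport (hps i).mul_right
  have hLSI := logSobolev_pi n (w := fun x => w (L x)) (hw.comp L.contDiff)
    (hws.comp_homeomorph L.toHomeomorph)
  have hder : ∀ i x, pderiv' (fun x => w (L x)) i x = ∑ j, A j i * pderiv' w j (L x) := by
    intro i x
    have : HasFDerivAt (fun x => w (L x)) _ x :=
      ((hw.differentiable one_ne_zero (L x)).hasFDerivAt).comp x L.hasFDerivAt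
    rw [pderiv', this.fderiv, ContinuousLinearMap.comp_apply, fderiv_apply_eq_sum_pderiv']
    refine Finset.sum_congr rfl fun j _ => ?_
    congr 1
    change L (Pi.single i 1) j = A j i
    rw [hL]
    simp
  have hgrad : ∑ i, ∫ x, pderiv' (fun x => w (L x)) i x ^ 2 = |A.det|⁻¹ * (m / 4 * n) := by
    have h1 : ∀ i, ∫ x, pderiv' (fun x => w (L x)) i x ^ 2 =
        |A.det|⁻¹ * (m / 4 * (A.transpose * M * A) i i) := by
      intro i
      simp only [hder]
      simp only [hL]
      rw [integral_comp_mulVec hAdet0 (g := fun x => (∑ j, A j i * pderiv' w j x) ^ 2)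
        (by fun_prop)]
      congr 1
      have h2 : ∀ x, (∑ j, A j i * pderiv' w j x) ^ 2 =
          ∑ j, ∑ l, (A l i * A j i) * (pderiv' w l x * pderiv' w j x) := by
        intro x
        rw [sq, Finset.sum_mul_sum, Finset.sum_comm]
        refine Finset.sum_congr rfl fun j _ => Finset.sum_congr rfl fun l _ => ?_
        ring
      simp only [h2]
      rw [integral_finsetSum _ fun j _ => integrable_finsetSum _ fun l _ =>
        (hpi l j).const_mul _]
      simp only [integral_finsetSum _ fun l _ => (hpi l _).const_mul _, integral_const_mul, hMw,
        Matrix.mul_apply, Matrix.transpose_apply, Finset.mul_sum, Finset.sum_mul]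
      refine Finset.sum_congr rfl fun j _ => Finset.sum_congr rfl fun l _ => ?_
      ring
    have h3 : A.transpose * M * A = 1 := by
      rw [hB, ← Matrix.mul_assoc, ← Matrix.transpose_mul, hBA, Matrix.transpose_one,
        Matrix.one_mul, hBA]
    simp only [h1, h3, Matrix.one_apply_eq]
    simp
    ring
  have hwc := hw.continuous
  rw [hgrad] at hLSI
  simp only [hL] at hLSI
  rw [integral_comp_mulVec hAdet0 (g := fun x => w x ^ 2 * Real.log (w x ^ 2))
      (Real.continuous_mul_log.comp (hwc.pow 2)),
    integral_comp_mulVec hAdet0 (g := fun x => w x ^ 2) (hwc.pow 2), ← hmdef] at hLSI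
  have hd : 0 < |A.det| := abs_pos.2 hAdet0
  have hlogM : Real.log M.det = -2 * Real.log |A.det| := by
    rw [hdetM, hAdet, Real.log_abs, Real.log_inv, Real.log_pow]; push_cast; ring
  rw [Real.log_mul (inv_ne_zero hd.ne') hm.ne', Real.log_inv] at hLSI
  rw [hlogM]
  have := mul_le_mul_of_nonneg_left hLSI hd.le
  rw [← mul_assoc, mul_inv_cancel₀ hd.ne', one_mul] at this
  refine this.trans (le_of_eq ?_)
  field_simp
  ring

lemma pderiv'_mul {n : ℕ} {f g : (Fin n → ℝ) → ℝ} (hf : Differentiable ℝ f)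
    (hg : Differentiable ℝ g) (i : Fin n) (x : Fin n → ℝ) :
    pderiv' (fun x => f x * g x) i x = f x * pderiv' g i x + pderiv' f i x * g x := by
  have := ((hf x).hasFDerivAt.mul (hg x).hasFDerivAt).fderiv
  rw [pderiv']
  erw [this]
  simp [pderiv']
  ring

lemma pderiv'_apply {n : ℕ} (i j : Fin n) (x : Fin n → ℝ) :
    pderiv' (fun x => x i) j x = if i = j then 1 else 0 := by
  rw [pderiv', (hasFDerivAt_apply i x).fderiv]
  simp [Pi.single_apply]

lemma pderiv'_gaussian {n : ℕ} (c b : ℝ) (i : Fin n) (x : Fin n → ℝ) :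
    pderiv' (fun x : Fin n → ℝ => c * Real.exp (-(∑ j, x j ^ 2) / b)) i x =
      -(2 / b * x i) * (c * Real.exp (-(∑ j, x j ^ 2) / b)) := by
  have h1 : HasFDerivAt (fun x : Fin n → ℝ => ∑ j, x j ^ 2) _ x :=
    HasFDerivAt.fun_sum (u := Finset.univ) fun j _ => (hasFDerivAt_apply (𝕜 := ℝ) j x).pow 2
  have h2 := ((h1.neg.mul_const b⁻¹).exp.const_mul c).fderiv
  simp only [div_eq_mul_inv]
  rw [pderiv']
  erw [h2]
  simp [Pi.single_apply]
  ring

/-- The standard Gaussian density. -/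
noncomputable def gaussDensity (n : ℕ) (x : Fin n → ℝ) : ℝ :=
  (2 * Real.pi) ^ (-(n : ℝ) / 2) * Real.exp (-(∑ i, x i ^ 2) / 2)

/-- The square root of the standard Gaussian density. -/
noncomputable def sqrtGaussDensity (n : ℕ) (x : Fin n → ℝ) : ℝ :=
  (2 * Real.pi) ^ (-(n : ℝ) / 4) * Real.exp (-(∑ i, x i ^ 2) / 4)

lemma gaussDensity_pos {n : ℕ} (x : Fin n → ℝ) : 0 < gaussDensity n x := by
  unfold gaussDensity; positivity

lemma sqrtGaussDensity_sq {n : ℕ} (x : Fin n → ℝ) :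
    sqrtGaussDensity n x ^ 2 = gaussDensity n x := by
  unfold sqrtGaussDensity gaussDensity
  rw [mul_pow, ← Real.rpow_natCast, ← Real.rpow_mul (by positivity), ← Real.exp_nat_mul]
  congr 2 <;> push_cast <;> ring

lemma log_gaussDensity {n : ℕ} (x : Fin n → ℝ) :
    Real.log (gaussDensity n x) = -(n / 2 * Real.log (2 * Real.pi)) - (∑ i, x i ^ 2) / 2 := by
  unfold gaussDensity
  rw [Real.log_mul (by positivity) (Real.exp_pos _).ne', Real.log_exp,
    Real.log_rpow (by positivity)]
  ring

lemma contDiff_gaussDensity (n : ℕ) : ContDiff ℝ 1 (gaussDensity n) := by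
  unfold gaussDensity; fun_prop

lemma contDiff_sqrtGaussDensity (n : ℕ) : ContDiff ℝ 1 (sqrtGaussDensity n) := by
  unfold sqrtGaussDensity; fun_prop

lemma pderiv'_gaussDensity {n : ℕ} (i : Fin n) (x : Fin n → ℝ) :
    pderiv' (gaussDensity n) i x = -x i * gaussDensity n x := by
  have := pderiv'_gaussian ((2 * Real.pi) ^ (-(n : ℝ) / 2)) 2 i x
  refine this.trans ?_
  rw [gaussDensity]; ring

lemma pderiv'_sqrtGaussDensity {n : ℕ} (i : Fin n) (x : Fin n → ℝ) :
    pderiv' (sqrtGaussDensity n) i x = -(x i / 2) * sqrtGaussDensity n x := by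
  have := pderiv'_gaussian ((2 * Real.pi) ^ (-(n : ℝ) / 4)) 4 i x
  refine this.trans ?_
  rw [sqrtGaussDensity]; ring

lemma integral_stdGauss {n : ℕ} (g : (Fin n → ℝ) → ℝ) :
    ∫ x, g x ∂(stdGauss n) = ∫ x, g x * gaussDensity n x := by
  have hm : Measurable fun x => Real.toNNReal (gaussDensity n x) :=
    (contDiff_gaussDensity n).continuous.measurable.real_toNNReal
  have := integral_withDensity_eq_integral_smul (μ := volume) hm g
  refine Eq.trans this (integral_congr_ae (Filter.Eventually.of_forall fun x => ?_))
  simp [NNReal.smul_def, (gaussDensity_pos x).le, mul_comm]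

/-- The integral of a partial derivative of a compactly supported function vanishes. -/
lemma integral_pderiv'_eq_zero {n : ℕ} {h : (Fin n → ℝ) → ℝ} (hh : ContDiff ℝ 1 h)
    (hs : HasCompactSupport h) (j : Fin n) : ∫ x, pderiv' h j x = 0 := by
  have hc : Continuous fun x => pderiv' h j x :=
    (hh.continuous_fderiv one_ne_zero).clm_apply continuous_const
  have := integral_mul_fderiv_eq_neg_fderiv_mul_of_integrable (μ := volume)
    (f := fun _ : Fin n → ℝ => (1 : ℝ)) (g := h) (v := Pi.single j 1) (by simp)
    (by simpa [pderiv'] using hc.integrable_of_hasCompactSupport (hs.fderiv_apply ℝ _))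
    (by simpa using hh.continuous.integrable_of_hasCompactSupport hs)
    (fun x _ => differentiableAt_const _) (fun x _ => hh.differentiable one_ne_zero x)
  simpa [pderiv'] using this

section

variable {n : ℕ} {u : (Fin n → ℝ) → ℝ}

/-- Gaussian integration by parts for `xᵢ u ∂ⱼu`. -/
lemma integral_coord_mul_mul_pderiv' (hu : ContDiff ℝ 1 u) (hus : HasCompactSupport u)
    (hmom : ∀ i j : Fin n, (∫ x, x i * x j * (u x) ^ 2 * gaussDensity n x) =
      if i = j then (∫ x, (u x) ^ 2 * gaussDensity n x) else 0) (i j : Fin n) :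
    ∫ x, x i * u x * pderiv' u j x * gaussDensity n x = 0 := by
  have hud := hu.differentiable one_ne_zero
  have hG := contDiff_gaussDensity n
  have hGd := hG.differentiable one_ne_zero
  have hGc := hG.continuous
  have huc := hu.continuous
  have hxd : Differentiable ℝ fun x : Fin n → ℝ => x i := by fun_prop
  have hpc : Continuous fun x => pderiv' u j x :=
    (hu.continuous_fderiv one_ne_zero).clm_apply continuous_const
  have h0 := integral_pderiv'_eq_zero (h := fun x => x i * (gaussDensity n x * (u x * u x)))
    (by fun_prop) (by exact ((hus.mul_left).mul_left).mul_left) j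
  have hder : ∀ x, pderiv' (fun x => x i * (gaussDensity n x * (u x * u x))) j x =
      2 * (x i * u x * pderiv' u j x * gaussDensity n x)
        - x i * x j * (u x) ^ 2 * gaussDensity n x
        + (if i = j then 1 else 0) * ((u x) ^ 2 * gaussDensity n x) := by
    intro x
    rw [pderiv'_mul hxd (by fun_prop), pderiv'_mul hGd (by fun_prop), pderiv'_mul hud hud,
      pderiv'_apply, pderiv'_gaussDensity]
    ring
  have i1 : Integrable fun x => x i * u x * pderiv' u j x * gaussDensity n x :=
    Continuous.integrable_of_hasCompactSupport (by fun_prop)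
      (by exact ((hus.mul_left).mul_right).mul_right)
  have hus2 : HasCompactSupport fun x => u x ^ 2 :=
    hus.comp_left (g := fun t => t ^ 2) (by simp)
  have i2 : Integrable fun x => x i * x j * (u x) ^ 2 * gaussDensity n x :=
    Continuous.integrable_of_hasCompactSupport (by fun_prop)
      (by exact (hus2.mul_left).mul_right)
  have i3 : Integrable fun x => (u x) ^ 2 * gaussDensity n x :=
    Continuous.integrable_of_hasCompactSupport (by fun_prop) hus2.mul_right
  simp only [hder] at h0
  have i4 := (i1.const_mul 2).sub i2
  simp only [Pi.sub_def] at i4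
  rw [integral_add i4 (i3.const_mul _), integral_sub (i1.const_mul 2) i2, integral_const_mul,
    integral_const_mul, hmom] at h0
  split_ifs at h0 <;> linarith

/-- The Fisher information matrix of `u² γₙ` for isotropic `u²γₙ`. -/
lemma integral_pderiv'_mul_sqrtGaussDensity (hu : ContDiff ℝ 1 u) (hus : HasCompactSupport u)
    (hmom : ∀ i j : Fin n, (∫ x, x i * x j * (u x) ^ 2 * gaussDensity n x) =
      if i = j then (∫ x, (u x) ^ 2 * gaussDensity n x) else 0) (i j : Fin n) :
    ∫ x, pderiv' (fun x => u x * sqrtGaussDensity n x) i x *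
        pderiv' (fun x => u x * sqrtGaussDensity n x) j x =
      (∫ x, pderiv' u i x * pderiv' u j x * gaussDensity n x) +
        1 / 4 * (if i = j then (∫ x, (u x) ^ 2 * gaussDensity n x) else 0) := by
  have hud := hu.differentiable one_ne_zero
  have hGc := (contDiff_gaussDensity n).continuous
  have hHd := (contDiff_sqrtGaussDensity n).differentiable one_ne_zero
  have huc := hu.continuous
  have hpc : ∀ i, Continuous fun x => pderiv' u i x := fun i =>
    (hu.continuous_fderiv one_ne_zero).clm_apply continuous_const
  have hps : ∀ i, HasCompactSupport fun x => pderiv' u i x := fun i => hus.fderiv_apply ℝ _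
  have hpt : ∀ x, pderiv' (fun x => u x * sqrtGaussDensity n x) i x *
        pderiv' (fun x => u x * sqrtGaussDensity n x) j x =
      pderiv' u i x * pderiv' u j x * gaussDensity n x +
        ((-1 / 2) * (x i * u x * pderiv' u j x * gaussDensity n x) +
        ((-1 / 2) * (x j * u x * pderiv' u i x * gaussDensity n x) +
        1 / 4 * (x i * x j * (u x) ^ 2 * gaussDensity n x))) := by
    intro x
    rw [pderiv'_mul hud hHd, pderiv'_mul hud hHd, pderiv'_sqrtGaussDensity,
      pderiv'_sqrtGaussDensity, ← sqrtGaussDensity_sq]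
    ring
  have i1 : ∀ i j, Integrable fun x => x i * u x * pderiv' u j x * gaussDensity n x := by
    intro i j
    have := hpc j
    exact Continuous.integrable_of_hasCompactSupport (by fun_prop)
      (by exact ((hus.mul_left).mul_right).mul_right)
  have i2 : Integrable fun x => x i * x j * (u x) ^ 2 * gaussDensity n x :=
    Continuous.integrable_of_hasCompactSupport (by fun_prop)
      (by exact ((hus.comp_left (g := fun t => t ^ 2) (by simp)).mul_left).mul_right)
  have i0 : Integrable fun x => pderiv' u i x * pderiv' u j x * gaussDensity n x :=
    (((hpc i).mul (hpc j)).mul hGc).integrable_of_hasCompactSupport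
      (by exact ((hps i).mul_right).mul_right)
  simp only [hpt]
  rw [integral_add i0 (((i1 i j).const_mul _).fun_add (((i1 j i).const_mul _).fun_add
      (i2.const_mul _))), integral_add ((i1 i j).const_mul _) (((i1 j i).const_mul _).fun_add
      (i2.const_mul _)), integral_add ((i1 j i).const_mul _) (i2.const_mul _),
    integral_const_mul, integral_const_mul, integral_const_mul,
    integral_coord_mul_mul_pderiv' hu hus hmom, integral_coord_mul_mul_pderiv' hu hus hmom, hmom]
  ring

/-- The matrix `(4/m) ∫ (∇u)^{⊗2} dγₙ + Id` is positive definite. -/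
lemma posDef_fisher (hu : ContDiff ℝ 1 u) (hus : HasCompactSupport u) {m : ℝ} (hm : 0 < m) :
    ((4 / m) • (Matrix.of fun i j : Fin n =>
        ∫ x, pderiv' u i x * pderiv' u j x * gaussDensity n x) +
      (1 : Matrix (Fin n) (Fin n) ℝ)).PosDef := by
  have hpc : ∀ i, Continuous fun x => pderiv' u i x := fun i =>
    (hu.continuous_fderiv one_ne_zero).clm_apply continuous_const
  have hps : ∀ i, HasCompactSupport fun x => pderiv' u i x := fun i => hus.fderiv_apply ℝ _
  have i0 : ∀ i j, Integrable fun x => pderiv' u i x * pderiv' u j x * gaussDensity n x :=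
    fun i j => (((hpc i).mul (hpc j)).mul (contDiff_gaussDensity n).continuous)
      |>.integrable_of_hasCompactSupport (by exact ((hps i).mul_right).mul_right)
  refine Matrix.PosDef.posSemidef_add (Matrix.PosSemidef.smul ?_ (by positivity)) Matrix.PosDef.one
  refine Matrix.PosSemidef.of_dotProduct_mulVec_nonneg ?_ fun v => ?_
  · ext i j
    simp [mul_comm]
  · have : dotProduct (star v) (Matrix.mulVec (Matrix.of fun i j : Fin n =>
        ∫ x, pderiv' u i x * pderiv' u j x * gaussDensity n x) v) =
        ∫ x, (∑ i, v i * pderiv' u i x) ^ 2 * gaussDensity n x := by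
      have h2 : ∀ x, (∑ i, v i * pderiv' u i x) ^ 2 * gaussDensity n x =
          ∑ i, ∑ j, (v i * v j) * (pderiv' u i x * pderiv' u j x * gaussDensity n x) := by
        intro x
        rw [sq, Finset.sum_mul_sum, Finset.sum_mul]
        refine Finset.sum_congr rfl fun i _ => ?_
        rw [Finset.sum_mul]
        refine Finset.sum_congr rfl fun j _ => ?_
        ring
      simp only [h2]
      rw [integral_finsetSum _ fun j _ => integrable_finsetSum _ fun l _ =>
        (i0 j l).const_mul _]
      simp only [integral_finsetSum _ fun l _ => (i0 _ l).const_mul _, integral_const_mul,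
        dotProduct, Matrix.mulVec, Matrix.of_apply, Finset.mul_sum]
      refine Finset.sum_congr rfl fun i _ => Finset.sum_congr rfl fun j _ => ?_
      simp
      ring
    rw [this]
    exact integral_nonneg fun x => mul_nonneg (sq_nonneg _) (gaussDensity_pos x).le

/-- The intrinsic dimensional logarithmic Sobolev inequality. -/
lemma dimensional_logSobolev (hu : ContDiff ℝ 1 u) (hus : HasCompactSupport u)
    (hmom : ∀ i j : Fin n, (∫ x, x i * x j * (u x) ^ 2 * gaussDensity n x) =
      if i = j then (∫ x, (u x) ^ 2 * gaussDensity n x) else 0)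
    (hm : 0 < ∫ x, (u x) ^ 2 * gaussDensity n x) :
    ∫ x, u x ^ 2 * Real.log (u x ^ 2) * gaussDensity n x ≤
      (∫ x, u x ^ 2 * gaussDensity n x) * (Real.log (∫ x, u x ^ 2 * gaussDensity n x) +
        Real.log (((4 / ∫ x, u x ^ 2 * gaussDensity n x) • (Matrix.of fun i j : Fin n =>
          ∫ x, pderiv' u i x * pderiv' u j x * gaussDensity n x) +
            (1 : Matrix (Fin n) (Fin n) ℝ)).det) / 2) := by
  have hGc := (contDiff_gaussDensity n).continuous
  have huc := hu.continuous
  have hus2 : HasCompactSupport fun x => u x ^ 2 :=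
    hus.comp_left (g := fun t => t ^ 2) (by simp)
  have hsq : ∀ x, (u x * sqrtGaussDensity n x) ^ 2 = u x ^ 2 * gaussDensity n x := fun x => by
    rw [mul_pow, sqrtGaussDensity_sq]
  set m := ∫ x, u x ^ 2 * gaussDensity n x with hmdef
  have h := logSobolev_det (w := fun x => u x * sqrtGaussDensity n x)
    (hu.mul (contDiff_sqrtGaussDensity n)) hus.mul_right (by simpa only [hsq] using hm)
    (posDef_fisher hu hus hm)
    (fun i j => by
      rw [integral_pderiv'_mul_sqrtGaussDensity hu hus hmom]
      simp only [hsq, ← hmdef, Matrix.add_apply, Matrix.smul_apply, Matrix.of_apply,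
        Matrix.one_apply, smul_eq_mul]
      split_ifs <;> field_simp <;> ring)
  simp only [hsq, ← hmdef] at h
  have hpt : ∀ x, u x ^ 2 * gaussDensity n x * Real.log (u x ^ 2 * gaussDensity n x) =
      u x ^ 2 * Real.log (u x ^ 2) * gaussDensity n x +
        (-(n / 2 * Real.log (2 * Real.pi)) * (u x ^ 2 * gaussDensity n x) +
        ∑ i, (-1 / 2) * (x i * x i * u x ^ 2 * gaussDensity n x)) := by
    intro x
    rcases eq_or_ne (u x) 0 with h0 | h0
    · simp [h0]
    · rw [Real.log_mul (by positivity) (gaussDensity_pos x).ne', log_gaussDensity]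
      simp only [← Finset.mul_sum, ← Finset.sum_mul, ← sq]
      ring
  have i1 : Integrable fun x => u x ^ 2 * Real.log (u x ^ 2) * gaussDensity n x :=
    ((Real.continuous_mul_log.comp (huc.pow 2)).mul hGc).integrable_of_hasCompactSupport
      ((hus2.comp_left (g := fun t => t * Real.log t) (by simp)).mul_right)
  have i2 : Integrable fun x => u x ^ 2 * gaussDensity n x :=
    Continuous.integrable_of_hasCompactSupport (by fun_prop) hus2.mul_right
  have i3 : ∀ i, Integrable fun x => x i * x i * u x ^ 2 * gaussDensity n x := fun i =>
    Continuous.integrable_of_hasCompactSupport (by fun_prop)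
      (by exact (hus2.mul_left).mul_right)
  simp only [hpt] at h
  have i4 := integrable_finsetSum Finset.univ fun i (_ : i ∈ Finset.univ) =>
    (i3 i).const_mul (-1 / 2)
  rw [integral_add i1 ((i2.const_mul _).fun_add i4), integral_add (i2.const_mul _) i4,
    integral_finsetSum _ fun i _ => (i3 i).const_mul _, integral_const_mul] at h
  simp only [integral_const_mul, hmom, if_true, ← hmdef] at h
  simp only [Finset.sum_const, Finset.card_univ, Fintype.card_fin, nsmul_eq_mul] at h
  linarith

end

/-- **Intrinsic dimensional Beckner inequality** (Theorem 1.1 / Theorem 4.1):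
if `u ∈ C_c^∞(ℝⁿ)`, `u ≢ 0`, satisfies `∫ xᵢxⱼ u² dγₙ = δᵢⱼ ‖u‖²_{L₂(γₙ)}`, then for every
`p ∈ [1,2)`,
`(‖u‖²_{L₂} − ‖u‖²_{L_p})/‖u‖²_{L₂} ≤ 1 − det( (4/‖u‖²_{L₂}) ∫ (∇u)^{⊗2} dγₙ + Idₙ )^{−(2−p)/(2p)}`. -/
theorem stmt_6 {n : ℕ} (u : (Fin n → ℝ) → ℝ)
    (hu : ContDiff ℝ (⊤ : ℕ∞) u) (hu' : HasCompactSupport u) (hu0 : u ≠ 0)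
    (hmom : ∀ i j : Fin n,
      (∫ x, x i * x j * (u x) ^ 2 ∂(stdGauss n)) =
        if i = j then (∫ x, (u x) ^ 2 ∂(stdGauss n)) else 0)
    (p : ℝ) (hp1 : 1 ≤ p) (hp2 : p < 2) :
    ((∫ x, (u x) ^ 2 ∂(stdGauss n)) -
        ((∫ x, |u x| ^ p ∂(stdGauss n)) ^ (2 / p))) /
      (∫ x, (u x) ^ 2 ∂(stdGauss n)) ≤
      1 - (Matrix.det
        ((4 / (∫ x, (u x) ^ 2 ∂(stdGauss n))) •
            (Matrix.of fun i j : Fin n =>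
              ∫ x, pderiv' u i x * pderiv' u j x ∂(stdGauss n)) +
          (1 : Matrix (Fin n) (Fin n) ℝ))) ^ (-(2 - p) / (2 * p)) := by
  have hu1 : ContDiff ℝ 1 u := hu.of_le (by exact_mod_cast le_top)
  have huc := hu1.continuous
  have hGc := (contDiff_gaussDensity n).continuous
  have hus2 : HasCompactSupport fun x => u x ^ 2 :=
    hu'.comp_left (g := fun t => t ^ 2) (by simp)
  simp only [integral_stdGauss] at hmom ⊢
  obtain ⟨x₀, hx₀⟩ := Function.ne_iff.1 hu0
  have hm : 0 < ∫ x, u x ^ 2 * gaussDensity n x :=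
    Continuous.integral_pos_of_hasCompactSupport_nonneg_nonzero (x := x₀) (by fun_prop)
      hus2.mul_right (fun x => mul_nonneg (sq_nonneg _) (gaussDensity_pos x).le)
      (mul_ne_zero (pow_ne_zero 2 hx₀) (gaussDensity_pos x₀).ne')
  have hent := dimensional_logSobolev hu1 hu' hmom hm
  have hdet := (posDef_fisher hu1 hu' hm).det_pos
  set m := ∫ x, u x ^ 2 * gaussDensity n x with hmdef
  set d := Matrix.det ((4 / m) • (Matrix.of fun i j : Fin n =>
    ∫ x, pderiv' u i x * pderiv' u j x * gaussDensity n x) + 1) with hddef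
  have hp0 : 0 < p := by linarith
  set s := (p - 2) / 2 * (Real.log m + Real.log d / 2) with hs
  have i1 : Integrable fun x => u x ^ 2 * Real.log (u x ^ 2) * gaussDensity n x :=
    ((Real.continuous_mul_log.comp (huc.pow 2)).mul hGc).integrable_of_hasCompactSupport
      ((hus2.comp_left (g := fun t => t * Real.log t) (by simp)).mul_right)
  have i2 : Integrable fun x => u x ^ 2 * gaussDensity n x :=
    Continuous.integrable_of_hasCompactSupport (by fun_prop) hus2.mul_right
  have ip : Integrable fun x => |u x| ^ p * gaussDensity n x :=
    ((huc.abs.rpow_const fun _ => Or.inr hp0.le).mul hGc).integrable_of_hasCompactSupport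
      ((hu'.comp_left (g := fun t => |t| ^ p) (by simp [hp0.ne'])).mul_right)
  have hpt : ∀ x, Real.exp s * (1 - s) * (u x ^ 2 * gaussDensity n x) +
      Real.exp s * ((p - 2) / 2) * (u x ^ 2 * Real.log (u x ^ 2) * gaussDensity n x) ≤
        |u x| ^ p * gaussDensity n x := by
    intro x
    rcases eq_or_ne (u x) 0 with h0 | h0
    · simp [h0, hp0.ne']
    have habs : 0 < |u x| := abs_pos.2 h0
    have hpow : |u x| ^ p = u x ^ 2 * (Real.exp s *
        Real.exp ((p - 2) / 2 * Real.log (u x ^ 2) - s)) := by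
      rw [← Real.exp_add, ← sq_abs, Real.log_pow, Real.rpow_def_of_pos habs]
      nth_rewrite 2 [← Real.exp_log habs]
      rw [← Real.exp_nat_mul, ← Real.exp_add]
      congr 1
      push_cast
      ring
    have h1 := Real.add_one_le_exp ((p - 2) / 2 * Real.log (u x ^ 2) - s)
    have h2 : 0 ≤ u x ^ 2 * Real.exp s * gaussDensity n x := by
      have := (gaussDensity_pos x).le
      positivity
    rw [hpow]
    have := mul_le_mul_of_nonneg_left h1 h2
    linarith
  have hint := integral_mono ((i2.const_mul _).fun_add (i1.const_mul _)) ip hpt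
  rw [integral_add (i2.const_mul _) (i1.const_mul _), integral_const_mul, integral_const_mul,
    ← hmdef] at hint
  have hlow : m * Real.exp s ≤ ∫ x, |u x| ^ p * gaussDensity n x := by
    refine le_trans ?_ hint
    have hc : 0 ≤ Real.exp s * ((2 - p) / 2) :=
      mul_nonneg (Real.exp_pos s).le (by linarith)
    have := mul_le_mul_of_nonneg_left hent hc
    have hs' : Real.exp s * ((2 - p) / 2) * (m * (Real.log m + Real.log d / 2)) =
        -(Real.exp s * m * s) := by
      rw [hs]; ring
    linarith
  have hfinal : m * d ^ (-(2 - p) / (2 * p)) ≤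
      (∫ x, |u x| ^ p * gaussDensity n x) ^ (2 / p) := by
    refine le_trans (le_of_eq ?_)
      (Real.rpow_le_rpow (by positivity) hlow (by positivity : 0 ≤ 2 / p))
    nth_rewrite 1 2 [← Real.exp_log hm]
    rw [Real.rpow_def_of_pos hdet, ← Real.exp_add, ← Real.exp_add, ← Real.exp_mul]
    congr 1
    rw [hs]
    field_simp
    ring
  rw [sub_div, div_self hm.ne']
  have : d ^ (-(2 - p) / (2 * p)) ≤ (∫ x, |u x| ^ p * gaussDensity n x) ^ (2 / p) / m := by
    rw [le_div_iff₀ hm, mul_comm]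
    exact hfinal
  linarith
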